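/- Let p : ℕ → [1,∞] with pointwise conjugate p* given by 1/p(n) + 1/p*(n) = 1, and let X be the closed linear span of the canonical unit vectors (e_n) in ℓ^{p(·)}. Then the map sending y = (y_n) ∈ ℓ^{p*(·)} to the functional x ↦ ∑_{n} x_n y_n is a well-defined linear isometric bijection from ℓ^{p*(·)} (with norm Φ_{p*}) onto the continuous dual space X* (with the dual operator norm). -/

import Mathlib

open scoped ENNReal

/-- `t ⊞_p s`: for `p < ∞`, `(t^p + s^p)^(1/p)`; for `p = ∞`, `max t s`. -/
noncomputable def boxPlus (p : ℝ≥0∞) (t s : ℝ) : ℝ :=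
  if p = ∞ then max t s else (t ^ p.toReal + s ^ p.toReal) ^ (1 / p.toReal)

/-- The recursively defined seminorms `|||x|||_(k)` (0-indexed). -/
noncomputable def seqNorm (p : ℕ → ℝ≥0∞) (x : ℕ → ℝ) : ℕ → ℝ
  | 0 => boxPlus (p 0) |x 0| |x 1|
  | k + 1 => boxPlus (p (k + 1)) (seqNorm p x k) |x (k + 2)|

/-- `Φ_p(x) = lim_k |||x|||_(k)`, as the supremum of the nondecreasing sequence. -/
noncomputable def Phi (p : ℕ → ℝ≥0∞) (x : ℕ → ℝ) : ℝ≥0∞ :=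
  ⨆ k, ENNReal.ofReal (seqNorm p x k)

/-- `x` is a bounded real sequence, i.e. `x ∈ ℓ^∞`. -/
def IsBddSeq (x : ℕ → ℝ) : Prop := ∃ M : ℝ, ∀ n, |x n| ≤ M

/-- Membership in the variable exponent space `ℓ^{p(·)}`. -/
def MemVLp (p : ℕ → ℝ≥0∞) (x : ℕ → ℝ) : Prop := IsBddSeq x ∧ Phi p x < ⊤

/-- A finitely supported sequence, i.e. a member of the linear span of the
canonical unit vectors. -/
def FinSupported (z : ℕ → ℝ) : Prop := ∃ m : ℕ, ∀ j, m ≤ j → z j = 0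

/-- Membership in the closed linear span `X = [(e_n)]` of the canonical unit
vectors inside `ℓ^{p(·)}`. -/
def InClosedSpan (p : ℕ → ℝ≥0∞) (x : ℕ → ℝ) : Prop :=
  IsBddSeq x ∧ Phi p x < ⊤ ∧
    ∀ ε : ℝ, 0 < ε → ∃ z : ℕ → ℝ, FinSupported z ∧ Phi p (x - z) < ENNReal.ofReal ε

theorem toReal_pos_of_one_le {p : ℝ≥0∞} (hp : 1 ≤ p) (h : p ≠ ∞) : 0 < p.toReal :=
  ENNReal.toReal_pos (fun h0 => by simp [h0] at hp) h

theorem conj_cases {p q : ℝ≥0∞} (h : 1 / p + 1 / q = 1) :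
    (p = ∞ ∧ q = 1) ∨ (p = 1 ∧ q = ∞) ∨
      (p ≠ ∞ ∧ q ≠ ∞ ∧ p.toReal.HolderConjugate q.toReal) := by
  simp only [one_div] at h
  by_cases hp : p = ∞
  · left
    subst hp
    simpa using h
  by_cases hq : q = ∞
  · right; left
    subst hq
    simpa using h
  right; right
  refine ⟨hp, hq, ?_⟩
  have : ENNReal.HolderConjugate p q := ENNReal.holderConjugate_iff.mpr h
  exact ENNReal.HolderConjugate.toReal_of_ne_top hp hq

theorem one_le_conj {p q : ℝ≥0∞} (h : 1 / p + 1 / q = 1) : 1 ≤ q := by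
  have h2 : 1 / q ≤ 1 := (le_add_self (a := 1 / q) (b := 1 / p)).trans h.le
  simpa using h2

theorem boxPlus_left_le {p : ℝ≥0∞} (hp : 1 ≤ p) {t s : ℝ} (ht : 0 ≤ t) (hs : 0 ≤ s) :
    t ≤ boxPlus p t s := by
  unfold boxPlus
  split_ifs with h
  · exact le_max_left _ _
  · have hr := toReal_pos_of_one_le hp h
    calc t = (t ^ p.toReal) ^ (1 / p.toReal) := by
          rw [← Real.rpow_mul ht, mul_one_div_cancel hr.ne', Real.rpow_one]
      _ ≤ _ := by
          have := Real.rpow_nonneg hs p.toReal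
          have := Real.rpow_nonneg ht p.toReal
          apply Real.rpow_le_rpow <;> first | positivity | linarith

theorem boxPlus_comm (p : ℝ≥0∞) (t s : ℝ) : boxPlus p t s = boxPlus p s t := by
  unfold boxPlus
  rw [max_comm, add_comm]

theorem boxPlus_right_le {p : ℝ≥0∞} (hp : 1 ≤ p) {t s : ℝ} (ht : 0 ≤ t) (hs : 0 ≤ s) :
    s ≤ boxPlus p t s := by
  rw [boxPlus_comm]
  exact boxPlus_left_le hp hs ht

theorem boxPlus_zero {p : ℝ≥0∞} (hp : 1 ≤ p) {t : ℝ} (ht : 0 ≤ t) : boxPlus p t 0 = t := by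
  unfold boxPlus
  split_ifs with h
  · exact max_eq_left ht
  · have hr := toReal_pos_of_one_le hp h
    rw [Real.zero_rpow hr.ne', add_zero, ← Real.rpow_mul ht, mul_one_div_cancel hr.ne',
      Real.rpow_one]

theorem boxPlus_mono_left {p : ℝ≥0∞} {t t' s : ℝ} (ht : 0 ≤ t) (htt : t ≤ t')
    (hs : 0 ≤ s) : boxPlus p t s ≤ boxPlus p t' s := by
  unfold boxPlus
  split_ifs with h
  · exact max_le_max_right _ htt
  · have := Real.rpow_nonneg hs p.toReal
    have := Real.rpow_nonneg ht p.toReal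
    have := Real.rpow_le_rpow ht htt (z := p.toReal) ENNReal.toReal_nonneg
    apply Real.rpow_le_rpow <;> first | positivity | linarith

theorem boxPlus_mul {p : ℝ≥0∞} (hp : 1 ≤ p) {c t s : ℝ} (hc : 0 ≤ c) (ht : 0 ≤ t)
    (hs : 0 ≤ s) : boxPlus p (c * t) (c * s) = c * boxPlus p t s := by
  unfold boxPlus
  split_ifs with h
  · exact (mul_max_of_nonneg _ _ hc).symm
  · have hr := toReal_pos_of_one_le hp h
    have h1 := Real.rpow_nonneg hs p.toReal
    have h2 := Real.rpow_nonneg ht p.toReal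
    rw [Real.mul_rpow hc ht, Real.mul_rpow hc hs, ← mul_add, Real.mul_rpow (by positivity)
      (by positivity), ← Real.rpow_mul hc, mul_one_div_cancel hr.ne', Real.rpow_one]

theorem boxPlus_one (t s : ℝ) : boxPlus 1 t s = t + s := by
  simp [boxPlus]

theorem boxPlus_top (t s : ℝ) : boxPlus ∞ t s = max t s := by
  simp [boxPlus]

theorem boxPlus_holder {p q : ℝ≥0∞} (h : 1 / p + 1 / q = 1) {a b t s : ℝ} (ha : 0 ≤ a)
    (hb : 0 ≤ b) (ht : 0 ≤ t) (hs : 0 ≤ s) :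
    a * t + b * s ≤ boxPlus p a b * boxPlus q t s := by
  rcases conj_cases h with ⟨rfl, rfl⟩ | ⟨rfl, rfl⟩ | ⟨hp, hq, hpq⟩
  · rw [boxPlus_one, boxPlus_top]
    have h1 := mul_le_mul_of_nonneg_right (le_max_left a b) ht
    have h2 := mul_le_mul_of_nonneg_right (le_max_right a b) hs
    linarith
  · rw [boxPlus_one, boxPlus_top]
    have h1 := mul_le_mul_of_nonneg_left (le_max_left t s) ha
    have h2 := mul_le_mul_of_nonneg_left (le_max_right t s) hb
    linarith
  · have := Real.inner_le_Lp_mul_Lq (Finset.univ : Finset (Fin 2)) ![a, b] ![t, s] hpq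
    simpa [boxPlus, hp, hq, Fin.sum_univ_two, abs_of_nonneg ha, abs_of_nonneg hb,
      abs_of_nonneg ht, abs_of_nonneg hs] using this

theorem boxPlus_attain {p q : ℝ≥0∞} (h : 1 / p + 1 / q = 1) {t s : ℝ}
    (ht : 0 ≤ t) (hs : 0 ≤ s) :
    ∃ a b : ℝ, 0 ≤ a ∧ 0 ≤ b ∧ boxPlus p a b ≤ 1 ∧ a * t + b * s = boxPlus q t s := by
  rcases conj_cases h with ⟨rfl, rfl⟩ | ⟨rfl, rfl⟩ | ⟨hp, hq, hpq⟩
  · refine ⟨1, 1, zero_le_one, zero_le_one, ?_, ?_⟩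
    · rw [boxPlus_top]; simp
    · rw [boxPlus_one]; ring
  · rcases le_total s t with hst | hst
    · refine ⟨1, 0, zero_le_one, le_rfl, ?_, ?_⟩
      · rw [boxPlus_one]; simp
      · rw [boxPlus_top, max_eq_left hst]; ring
    · refine ⟨0, 1, le_rfl, zero_le_one, ?_, ?_⟩
      · rw [boxPlus_one]; simp
      · rw [boxPlus_top, max_eq_right hst]; ring
  · lift t to NNReal using ht
    lift s to NNReal using hs
    obtain ⟨g, hg, hgs⟩ :=
      (NNReal.isGreatest_Lp (Finset.univ : Finset (Fin 2)) ![t, s] hpq.symm).1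
    simp only [Fin.sum_univ_two, Set.mem_ofPred_eq, Matrix.cons_val_zero,
      Matrix.cons_val_one] at hg hgs
    refine ⟨g 0, g 1, (g 0).2, (g 1).2, ?_, ?_⟩
    · rw [boxPlus, if_neg hp]
      have h1 : (((g 0 : NNReal) : ℝ) ^ p.toReal + ((g 1 : NNReal) : ℝ) ^ p.toReal) ≤ 1 := by
        exact_mod_cast hg
      apply Real.rpow_le_one _ h1 (by simp)
      positivity
    · rw [boxPlus, if_neg hq]
      have h2 := congrArg (fun z : NNReal => (z : ℝ)) hgs
      push_cast at h2
      rw [← h2]; ring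

theorem seqNorm_nonneg {p : ℕ → ℝ≥0∞} (hp : ∀ n, 1 ≤ p n) (x : ℕ → ℝ) (k : ℕ) :
    0 ≤ seqNorm p x k := by
  induction k with
  | zero => exact (abs_nonneg _).trans (boxPlus_left_le (hp 0) (abs_nonneg _) (abs_nonneg _))
  | succ k ih => exact ih.trans (boxPlus_left_le (hp _) ih (abs_nonneg _))

theorem seqNorm_mono {p : ℕ → ℝ≥0∞} (hp : ∀ n, 1 ≤ p n) (x : ℕ → ℝ) :
    Monotone (seqNorm p x) :=
  monotone_nat_of_le_succ fun k =>
    boxPlus_left_le (hp _) (seqNorm_nonneg hp x k) (abs_nonneg _)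

theorem abs_le_seqNorm {p : ℕ → ℝ≥0∞} (hp : ∀ n, 1 ≤ p n) (x : ℕ → ℝ) (n : ℕ) :
    |x n| ≤ seqNorm p x n := by
  rcases n with _ | _ | n
  · exact boxPlus_left_le (hp 0) (abs_nonneg _) (abs_nonneg _)
  · exact (boxPlus_right_le (hp 0) (abs_nonneg _) (abs_nonneg _)).trans
      (seqNorm_mono hp x (Nat.zero_le 1))
  · have h1 : |x (n + 2)| ≤ seqNorm p x (n + 1) :=
      boxPlus_right_le (hp (n + 1)) (seqNorm_nonneg hp x n) (abs_nonneg _)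
    exact h1.trans (seqNorm_mono hp x (Nat.le_succ (n + 1)))

theorem seqNorm_congr (p : ℕ → ℝ≥0∞) {x x' : ℕ → ℝ} (k : ℕ) (h : ∀ j < k + 2, x j = x' j) :
    seqNorm p x k = seqNorm p x' k := by
  induction k with
  | zero => simp [seqNorm, h 0 (by omega), h 1 (by omega)]
  | succ k ih =>
    rw [seqNorm, seqNorm, ih fun j hj => h j (by omega), h (k + 2) (by omega)]

theorem seqNorm_smul {p : ℕ → ℝ≥0∞} (hp : ∀ n, 1 ≤ p n) {c : ℝ} (hc : 0 ≤ c) (x : ℕ → ℝ)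
    (k : ℕ) : seqNorm p (fun n => c * x n) k = c * seqNorm p x k := by
  induction k with
  | zero =>
    simp only [seqNorm, abs_mul, abs_of_nonneg hc]
    exact boxPlus_mul (hp 0) hc (abs_nonneg _) (abs_nonneg _)
  | succ k ih =>
    rw [seqNorm, seqNorm, ih, abs_mul, abs_of_nonneg hc]
    exact boxPlus_mul (hp _) hc (seqNorm_nonneg hp x k) (abs_nonneg _)

theorem seqNorm_holder {p q : ℕ → ℝ≥0∞} (hp : ∀ n, 1 ≤ p n)
    (h : ∀ n, 1 / p n + 1 / q n = 1) (x y : ℕ → ℝ) (k : ℕ) :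
    ∑ n ∈ Finset.range (k + 2), |x n * y n| ≤ seqNorm p x k * seqNorm q y k := by
  have hq : ∀ n, 1 ≤ q n := fun n => one_le_conj (h n)
  induction k with
  | zero =>
    simp only [Finset.sum_range_succ, Finset.sum_range_zero, zero_add, abs_mul]
    exact boxPlus_holder (h 0) (abs_nonneg _) (abs_nonneg _) (abs_nonneg _) (abs_nonneg _)
  | succ k ih =>
    rw [Finset.sum_range_succ, abs_mul]
    refine (add_le_add_left ih _).trans ?_
    exact boxPlus_holder (h (k + 1)) (seqNorm_nonneg hp x k) (abs_nonneg _)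
      (seqNorm_nonneg hq y k) (abs_nonneg _)

theorem exists_sgn (b s : ℝ) (hb : 0 ≤ b) : ∃ c : ℝ, |c| = b ∧ c * s = b * |s| := by
  rcases le_total 0 s with hs | hs
  · exact ⟨b, abs_of_nonneg hb, by rw [abs_of_nonneg hs]⟩
  · exact ⟨-b, by rw [abs_neg, abs_of_nonneg hb], by rw [abs_of_nonpos hs]; ring⟩

theorem seqNorm_attain {p q : ℕ → ℝ≥0∞} (hp : ∀ n, 1 ≤ p n)
    (h : ∀ n, 1 / p n + 1 / q n = 1) (y : ℕ → ℝ) (k : ℕ) :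
    ∃ x : ℕ → ℝ, (∀ j, k + 2 ≤ j → x j = 0) ∧ seqNorm p x k ≤ 1 ∧
      ∑ n ∈ Finset.range (k + 2), x n * y n = seqNorm q y k := by
  have hq : ∀ n, 1 ≤ q n := fun n => one_le_conj (h n)
  induction k with
  | zero =>
    obtain ⟨a, b, ha, hb, hab, he⟩ := boxPlus_attain (h 0) (abs_nonneg (y 0)) (abs_nonneg (y 1))
    obtain ⟨c, hc, hc'⟩ := exists_sgn a (y 0) ha
    obtain ⟨d, hd, hd'⟩ := exists_sgn b (y 1) hb
    refine ⟨fun n => if n = 0 then c else if n = 1 then d else 0, ?_, ?_, ?_⟩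
    · intro j hj
      dsimp only
      rw [if_neg (by omega), if_neg (by omega)]
    · simpa [seqNorm, hc, hd] using hab
    · simp [Finset.sum_range_succ, seqNorm, hc', hd', he]
  | succ k ih =>
    obtain ⟨x, hx0, hx1, hxs⟩ := ih
    obtain ⟨a, b, ha, hb, hab, he⟩ :=
      boxPlus_attain (h (k + 1)) (seqNorm_nonneg hq y k) (abs_nonneg (y (k + 2)))
    obtain ⟨d, hd, hd'⟩ := exists_sgn b (y (k + 2)) hb
    have hlt : ∀ j < k + 2, (if j = k + 2 then d else a * x j) = a * x j := fun j hj => by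
      rw [if_neg (by omega)]
    refine ⟨fun n => if n = k + 2 then d else a * x n, ?_, ?_, ?_⟩
    · intro j hj
      dsimp only
      rw [if_neg (by omega), hx0 j (by omega), mul_zero]
    · rw [seqNorm, seqNorm_congr p k hlt, seqNorm_smul hp ha, if_pos rfl, hd]
      refine le_trans (boxPlus_mono_left (mul_nonneg ha (seqNorm_nonneg hp x k)) ?_ hb) hab
      exact mul_le_of_le_one_right ha hx1
    · dsimp only
      rw [Finset.sum_range_succ, if_pos rfl, hd', seqNorm, ← he, ← hxs, Finset.mul_sum]
      congr 1
      refine Finset.sum_congr rfl fun j hj => ?_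
      rw [hlt j (Finset.mem_range.mp hj)]; ring

theorem le_Phi (p : ℕ → ℝ≥0∞) (x : ℕ → ℝ) (k : ℕ) :
    ENNReal.ofReal (seqNorm p x k) ≤ Phi p x :=
  le_iSup (fun k => ENNReal.ofReal (seqNorm p x k)) k

theorem seqNorm_le_toReal {p : ℕ → ℝ≥0∞} {x : ℕ → ℝ} (h : Phi p x < ⊤) (k : ℕ) :
    seqNorm p x k ≤ (Phi p x).toReal :=
  (ENNReal.ofReal_le_iff_le_toReal h.ne).mp (le_Phi p x k)

theorem Phi_fin {p : ℕ → ℝ≥0∞} (hp : ∀ n, 1 ≤ p n) {x : ℕ → ℝ} (m : ℕ)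
    (h : ∀ j, m + 2 ≤ j → x j = 0) : Phi p x = ENNReal.ofReal (seqNorm p x m) := by
  refine le_antisymm (iSup_le fun k => ENNReal.ofReal_le_ofReal ?_) (le_Phi p x m)
  rcases le_total k m with hk | hk
  · exact seqNorm_mono hp x hk
  · induction k, hk using Nat.le_induction with
    | base => exact le_rfl
    | succ k hk ih =>
      rw [seqNorm, h (k + 2) (by omega), abs_zero, boxPlus_zero (hp _) (seqNorm_nonneg hp x k)]
      exact ih

theorem Phi_zero {p : ℕ → ℝ≥0∞} (hp : ∀ n, 1 ≤ p n) : Phi p 0 = 0 := by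
  rw [Phi_fin hp (x := 0) 0 (fun _ _ => rfl)]
  simp [seqNorm, boxPlus_zero (hp 0) le_rfl]

theorem FinSupported.inClosedSpan {p : ℕ → ℝ≥0∞} (hp : ∀ n, 1 ≤ p n) {z : ℕ → ℝ}
    (hz : FinSupported z) : InClosedSpan p z := by
  have hz' := hz
  obtain ⟨m, hm⟩ := hz'
  have hPhi := Phi_fin hp m (fun j hj => hm j (by omega))
  have hlt : Phi p z < ⊤ := by rw [hPhi]; exact ENNReal.ofReal_lt_top
  refine ⟨⟨(Phi p z).toReal, fun n => (abs_le_seqNorm hp z n).trans (seqNorm_le_toReal hlt n)⟩,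
    hlt, fun ε hε => ⟨z, hz, ?_⟩⟩
  rw [sub_self, Phi_zero hp]
  exact ENNReal.ofReal_pos.mpr hε

theorem FinSupported.sub {z w : ℕ → ℝ} (hz : FinSupported z) (hw : FinSupported w) :
    FinSupported (z - w) := by
  obtain ⟨m, hm⟩ := hz
  obtain ⟨n, hn⟩ := hw
  refine ⟨max m n, fun j hj => ?_⟩
  simp [hm j (by omega), hn j (by omega)]

theorem InClosedSpan.sub_fin {p : ℕ → ℝ≥0∞} (hp : ∀ n, 1 ≤ p n) {x z : ℕ → ℝ}
    (hx : InClosedSpan p x) (hz : FinSupported z) (hlt : Phi p (x - z) < ⊤) :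
    InClosedSpan p (x - z) := by
  refine ⟨⟨(Phi p (x - z)).toReal, fun n => (abs_le_seqNorm hp _ n).trans
    (seqNorm_le_toReal hlt n)⟩, hlt, fun ε hε => ?_⟩
  obtain ⟨w, hw, hwε⟩ := hx.2.2 ε hε
  refine ⟨w - z, hw.sub hz, ?_⟩
  rwa [sub_sub_sub_cancel_right]

theorem sum_abs_le {p q : ℕ → ℝ≥0∞} (hp : ∀ n, 1 ≤ p n)
    (h : ∀ n, 1 / p n + 1 / q n = 1) {x y : ℕ → ℝ} (hx : Phi p x < ⊤) (hy : Phi q y < ⊤)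
    (k : ℕ) : ∑ n ∈ Finset.range k, |x n * y n| ≤ (Phi p x).toReal * (Phi q y).toReal := by
  have hq : ∀ n, 1 ≤ q n := fun n => one_le_conj (h n)
  calc ∑ n ∈ Finset.range k, |x n * y n| ≤ ∑ n ∈ Finset.range (k + 2), |x n * y n| :=
        Finset.sum_le_sum_of_subset_of_nonneg (Finset.range_subset_range.mpr (by omega))
          fun _ _ _ => abs_nonneg _
    _ ≤ seqNorm p x k * seqNorm q y k := seqNorm_holder hp h x y k
    _ ≤ _ := mul_le_mul (seqNorm_le_toReal hx k) (seqNorm_le_toReal hy k)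
        (seqNorm_nonneg hq y k) ENNReal.toReal_nonneg

theorem summable_abs_pair {p q : ℕ → ℝ≥0∞} (hp : ∀ n, 1 ≤ p n)
    (h : ∀ n, 1 / p n + 1 / q n = 1) {x y : ℕ → ℝ} (hx : Phi p x < ⊤) (hy : Phi q y < ⊤) :
    Summable fun n => |x n * y n| :=
  summable_of_sum_range_le (fun _ => abs_nonneg _) (sum_abs_le hp h hx hy)

theorem summable_pair {p q : ℕ → ℝ≥0∞} (hp : ∀ n, 1 ≤ p n)
    (h : ∀ n, 1 / p n + 1 / q n = 1) {x y : ℕ → ℝ} (hx : Phi p x < ⊤) (hy : Phi q y < ⊤) :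
    Summable fun n => x n * y n :=
  (summable_abs_pair hp h hx hy).of_abs

theorem abs_tsum_le {p q : ℕ → ℝ≥0∞} (hp : ∀ n, 1 ≤ p n)
    (h : ∀ n, 1 / p n + 1 / q n = 1) {x y : ℕ → ℝ} (hx : Phi p x < ⊤) (hy : Phi q y < ⊤) :
    |∑' n, x n * y n| ≤ (Phi p x).toReal * (Phi q y).toReal := by
  have hs := summable_abs_pair hp h hx hy
  have h1 : |∑' n, x n * y n| ≤ ∑' n, |x n * y n| := by
    simpa [Real.norm_eq_abs] using norm_tsum_le_tsum_norm (f := fun n => x n * y n)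
      (by simpa [Real.norm_eq_abs] using hs)
  exact h1.trans (Real.tsum_le_of_sum_range_le (fun _ => abs_nonneg _) (sum_abs_le hp h hx hy))

theorem tsum_fin {x y : ℕ → ℝ} (m : ℕ) (h : ∀ j, m ≤ j → x j = 0) :
    ∑' n, x n * y n = ∑ n ∈ Finset.range m, x n * y n :=
  tsum_eq_sum fun b hb => by
    rw [h b (by simpa using hb), zero_mul]

theorem single_fin (n : ℕ) (c : ℝ) : FinSupported (Pi.single n c) :=
  ⟨n + 1, fun j hj => by
    rw [Pi.single_eq_of_ne (by omega)]⟩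

/-- A linear functional acts on finitely supported sequences as a finite sum. -/
theorem functional_fin {p : ℕ → ℝ≥0∞} (hp : ∀ n, 1 ≤ p n) (f : (ℕ → ℝ) → ℝ)
    (hadd : ∀ x₁ x₂ : ℕ → ℝ, InClosedSpan p x₁ → InClosedSpan p x₂ →
        f (x₁ + x₂) = f x₁ + f x₂)
    (hsmul : ∀ (c : ℝ) (x : ℕ → ℝ), InClosedSpan p x → f (c • x) = c * f x) (m : ℕ) :
    ∀ z : ℕ → ℝ, (∀ j, m ≤ j → z j = 0) →
      f z = ∑ n ∈ Finset.range m, z n * f (Pi.single n 1) := by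
  induction m with
  | zero =>
    intro z hz
    have h0 : z = (0 : ℝ) • (0 : ℕ → ℝ) := by
      funext j; simp [hz j (Nat.zero_le j)]
    have h1 : FinSupported (0 : ℕ → ℝ) := ⟨0, fun _ _ => rfl⟩
    rw [h0, hsmul 0 0 (h1.inClosedSpan hp)]
    simp
  | succ m ih =>
    intro z hz
    have hw : ∀ j, m ≤ j → (z - Pi.single m (z m) : ℕ → ℝ) j = 0 := by
      intro j hj
      rcases eq_or_lt_of_le hj with rfl | hj
      · simp
      · simp [hz j hj, Pi.single_eq_of_ne (show j ≠ m by omega)]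
    have h1 : z = (z - Pi.single m (z m)) + Pi.single m (z m) := (sub_add_cancel _ _).symm
    have h2 : (Pi.single m (z m) : ℕ → ℝ) = z m • Pi.single m 1 := by
      rw [← Pi.single_smul, smul_eq_mul, mul_one]
    have h3 : FinSupported (z - Pi.single m (z m)) := ⟨m, hw⟩
    calc f z = f (z - Pi.single m (z m)) + f (Pi.single m (z m)) := by
          rw [← hadd _ _ (h3.inClosedSpan hp) ((single_fin m _).inClosedSpan hp), ← h1]
      _ = _ := by
          rw [ih _ hw, h2, hsmul _ _ ((single_fin m _).inClosedSpan hp), Finset.sum_range_succ,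
            ← h2]
          congr 1
          refine Finset.sum_congr rfl fun j hj => ?_
          have := Finset.mem_range.mp hj
          simp [Pi.single_eq_of_ne (show j ≠ m by omega)]

/-- The dual of `X = [(e_n)] ⊆ ℓ^{p(·)}` is `ℓ^{p*(·)}`: the pairing
`y ↦ (x ↦ ∑ₙ xₙ yₙ)` is a well-defined linear isometric bijection of
`ℓ^{p*(·)}` onto `X*`. -/
theorem dual_of_span (p pStar : ℕ → ℝ≥0∞) (hp : ∀ n, 1 ≤ p n)
    (hconj : ∀ n, 1 / p n + 1 / pStar n = 1) :
    -- well-definedness: each `y ∈ ℓ^{p*(·)}` gives a functional on `X`,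
    -- whose dual (operator) norm equals `Φ_{p*}(y)` (isometry)
    (∀ y : ℕ → ℝ, MemVLp pStar y →
      (∀ x : ℕ → ℝ, InClosedSpan p x → Summable fun n => x n * y n) ∧
      (⨆ x : {x : ℕ → ℝ // InClosedSpan p x ∧ Phi p x ≤ 1},
        ENNReal.ofReal |∑' n, (x : ℕ → ℝ) n * y n|) = Phi pStar y) ∧
    -- linearity of the pairing map
    (∀ y₁ y₂ : ℕ → ℝ, MemVLp pStar y₁ → MemVLp pStar y₂ →
      ∀ x : ℕ → ℝ, InClosedSpan p x →
        ∑' n, x n * (y₁ n + y₂ n) = (∑' n, x n * y₁ n) + ∑' n, x n * y₂ n) ∧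
    (∀ (c : ℝ) (y : ℕ → ℝ), MemVLp pStar y → ∀ x : ℕ → ℝ, InClosedSpan p x →
      ∑' n, x n * (c * y n) = c * ∑' n, x n * y n) ∧
    -- injectivity
    (∀ y₁ y₂ : ℕ → ℝ, MemVLp pStar y₁ → MemVLp pStar y₂ →
      (∀ x : ℕ → ℝ, InClosedSpan p x → ∑' n, x n * y₁ n = ∑' n, x n * y₂ n) →
      y₁ = y₂) ∧
    -- surjectivity: every continuous linear functional on `X` is of this form
    (∀ f : (ℕ → ℝ) → ℝ,
      (∀ x₁ x₂ : ℕ → ℝ, InClosedSpan p x₁ → InClosedSpan p x₂ →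
        f (x₁ + x₂) = f x₁ + f x₂) →
      (∀ (c : ℝ) (x : ℕ → ℝ), InClosedSpan p x → f (c • x) = c * f x) →
      (∃ C : ℝ, ∀ x : ℕ → ℝ, InClosedSpan p x → |f x| ≤ C * (Phi p x).toReal) →
      ∃ y : ℕ → ℝ, MemVLp pStar y ∧
        ∀ x : ℕ → ℝ, InClosedSpan p x → f x = ∑' n, x n * y n) := by
  have hq : ∀ n, 1 ≤ pStar n := fun n => one_le_conj (hconj n)
  refine ⟨fun y hy => ⟨fun x hx => summable_pair hp hconj hx.2.1 hy.2, ?_⟩, ?_, ?_, ?_, ?_⟩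
  · refine le_antisymm (iSup_le ?_) (iSup_le fun k => ?_)
    · rintro ⟨x, hx, hx1⟩
      rw [ENNReal.ofReal_le_iff_le_toReal hy.2.ne]
      refine (abs_tsum_le hp hconj hx.2.1 hy.2).trans ?_
      refine mul_le_of_le_one_left ENNReal.toReal_nonneg ?_
      exact ENNReal.toReal_le_of_le_ofReal zero_le_one (by simpa using hx1)
    · obtain ⟨x, hx0, hx1, hxs⟩ := seqNorm_attain hp hconj y k
      have hf : FinSupported x := ⟨k + 2, hx0⟩
      have h1 : Phi p x ≤ 1 := by
        rw [Phi_fin hp k hx0]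
        exact ENNReal.ofReal_le_one.mpr hx1
      refine le_trans ?_ (le_iSup (fun x : {x : ℕ → ℝ // InClosedSpan p x ∧ Phi p x ≤ 1} =>
        ENNReal.ofReal |∑' n, (x : ℕ → ℝ) n * y n|) ⟨x, hf.inClosedSpan hp, h1⟩)
      refine ENNReal.ofReal_le_ofReal ?_
      simp only
      rw [tsum_fin (k + 2) hx0, hxs]
      exact le_abs_self _
  · intro y₁ y₂ h₁ h₂ x hx
    simp only [mul_add]
    exact (summable_pair hp hconj hx.2.1 h₁.2).tsum_add (summable_pair hp hconj hx.2.1 h₂.2)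
  · intro c y _ x _
    rw [← tsum_mul_left]
    exact tsum_congr fun n => by ring
  · intro y₁ y₂ _ _ h
    funext n
    have := h (Pi.single n 1) ((single_fin n 1).inClosedSpan hp)
    rw [tsum_eq_single n, tsum_eq_single n] at this
    · simpa using this
    · intro j hj; simp [Pi.single_eq_of_ne hj]
    · intro j hj; simp [Pi.single_eq_of_ne hj]
  · rintro f hadd hsmul ⟨C, hC⟩
    have hfin := functional_fin hp f hadd hsmul
    set y : ℕ → ℝ := fun n => f (Pi.single n 1) with hy
    have hbound : ∀ k, seqNorm pStar y k ≤ |C| := by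
      intro k
      obtain ⟨x, hx0, hx1, hxs⟩ := seqNorm_attain hp hconj y k
      have hf : FinSupported x := ⟨k + 2, hx0⟩
      have h1 : (Phi p x).toReal ≤ 1 := by
        rw [Phi_fin hp k hx0, ENNReal.toReal_ofReal (seqNorm_nonneg hp x k)]
        exact hx1
      rw [← hxs, ← hfin (k + 2) x hx0]
      calc f x ≤ |f x| := le_abs_self _
        _ ≤ C * (Phi p x).toReal := hC x (hf.inClosedSpan hp)
        _ ≤ |C| * (Phi p x).toReal :=
            mul_le_mul_of_nonneg_right (le_abs_self C) ENNReal.toReal_nonneg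
        _ ≤ |C| := mul_le_of_le_one_right (abs_nonneg C) h1
    have hyPhi : Phi pStar y < ⊤ :=
      lt_of_le_of_lt (iSup_le fun k => ENNReal.ofReal_le_ofReal (hbound k))
        (ENNReal.ofReal_lt_top (r := |C|))
    refine ⟨y, ⟨⟨|C|, fun n => (abs_le_seqNorm hq y n).trans (hbound n)⟩, hyPhi⟩, ?_⟩
    intro x hx
    set K : ℝ := |C| + (Phi pStar y).toReal with hK
    have hK0 : 0 ≤ K := add_nonneg (abs_nonneg C) ENNReal.toReal_nonneg
    have key : ∀ ε : ℝ, 0 < ε → |f x - ∑' n, x n * y n| ≤ K * ε := by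
      intro ε hε
      obtain ⟨z, hz, hzε⟩ := hx.2.2 ε hε
      have hlt : Phi p (x - z) < ⊤ := hzε.trans ENNReal.ofReal_lt_top
      have hxz := hx.sub_fin hp hz hlt
      have hzs := hz.inClosedSpan hp
      have hle : (Phi p (x - z)).toReal ≤ ε :=
        ENNReal.toReal_le_of_le_ofReal hε.le hzε.le
      have e1 : f x = f (x - z) + f z := by
        rw [← hadd _ _ hxz hzs, sub_add_cancel]
      have e2 : f z = ∑' n, z n * y n := by
        obtain ⟨m, hm⟩ := hz
        rw [tsum_fin m hm, hfin m z hm]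
      have e3 : ∑' n, x n * y n = ∑' n, (x - z) n * y n + ∑' n, z n * y n := by
        rw [← (summable_pair hp hconj hlt hyPhi).tsum_add
          (summable_pair hp hconj hzs.2.1 hyPhi)]
        exact tsum_congr fun n => by simp only [Pi.sub_apply]; ring
      have e4 : f x - ∑' n, x n * y n = f (x - z) - ∑' n, (x - z) n * y n := by
        rw [e1, e2, e3]; ring
      have b1 : |f (x - z)| ≤ |C| * (Phi p (x - z)).toReal :=
        (hC _ hxz).trans (mul_le_mul_of_nonneg_right (le_abs_self C) ENNReal.toReal_nonneg)
      have b2 := abs_tsum_le hp hconj hlt hyPhi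
      rw [e4]
      calc _ ≤ |f (x - z)| + |∑' n, (x - z) n * y n| := abs_sub _ _
        _ ≤ K * (Phi p (x - z)).toReal := by rw [hK]; linarith
        _ ≤ K * ε := mul_le_mul_of_nonneg_left hle hK0
    have h0 : |f x - ∑' n, x n * y n| ≤ 0 := by
      refine le_of_forall_pos_le_add fun δ hδ => ?_
      have hk := key (δ / (K + 1)) (by positivity)
      have : K * (δ / (K + 1)) ≤ δ := by
        rw [mul_div_assoc', div_le_iff₀ (by positivity)]
        nlinarith
      linarith
    have := abs_nonpos_iff.mp h0
    linarith
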